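/- Classification of highest elements (C case): Let n ≥ 2 and l ≥ k ≥ 1, and let b_1 ⊗ b_2 ∈ B_l ⊗ B_k satisfy ẽ_i(b_1 ⊗ b_2) = 0 for all 1 ≤ i ≤ n, and x_0(b_1) = 0 or x_0(b_2) = 0. Then exactly one of the following holds: (type I) b_1 = (l,0,…,0) and b_2 = (x_1,x_2,---,x̄_1) for some nonnegative integers x_1, x_2, x̄_1 with x_1 + x_2 + x̄_1 ≤ k; or (type II) b_1 = (l−2y_0,0,---,0) and b_2 = (x_1,x_2,---,k−x_1−x_2) for some nonnegative integers y_0 ≠ 0, x_1, x_2 with l − k ≥ 2y_0 − x_1 and x_1 + x_2 ≤ k. -/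

import Mathlib

namespace KTT

/-- Raw data of a crystal element `(x_1,…,x_n,x̄_n,…,x̄_1)`:
`b.1 i` is `x_{i+1}` and `b.2 i` is `x̄_{i+1}` for `i : Fin n`. -/
abbrev Tup (n : ℕ) := (Fin n → ℕ) × (Fin n → ℕ)

/-- The entry `x_j` (for `1 ≤ j ≤ n`). -/
def xc {n : ℕ} (b : Tup n) (j : ℕ) : ℕ :=
  if h : j - 1 < n then b.1 ⟨j - 1, h⟩ else 0

/-- The entry `x̄_j` (for `1 ≤ j ≤ n`). -/
def xbc {n : ℕ} (b : Tup n) (j : ℕ) : ℕ :=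
  if h : j - 1 < n then b.2 ⟨j - 1, h⟩ else 0

/-- Set the entry indexed by `j` (i.e. `x_j`) to the value `v`. -/
def setx {n : ℕ} (f : Fin n → ℕ) (j v : ℕ) : Fin n → ℕ :=
  fun t => if (t : ℕ) + 1 = j then v else f t

/-- `Σ_{i=1}^n (x_i + x̄_i)`. -/
def tsum {n : ℕ} (b : Tup n) : ℕ := ∑ i, (b.1 i + b.2 i)

/-- The element `(v,0,…,0)`. -/
def uvec (n v : ℕ) : Tup n := (fun j => if (j : ℕ) = 0 then v else 0, fun _ => 0)

/-- The element `(0,v,---,0)` (only `x_2 = v` nonzero). -/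
def u2vec (n v : ℕ) : Tup n := (fun j => if (j : ℕ) = 1 then v else 0, fun _ => 0)

/-- The element `(0,0,---,v)` (only `x̄_1 = v` nonzero). -/
def barvec (n v : ℕ) : Tup n := (fun _ => 0, fun j => if (j : ℕ) = 0 then v else 0)

/-- The element `(a,c,---,d)` with `x_1 = a`, `x_2 = c`, `x̄_1 = d`, all else `0`. -/
def tripleVec (n a c d : ℕ) : Tup n :=
  (fun j => if (j : ℕ) = 0 then a else if (j : ℕ) = 1 then c else 0,
   fun j => if (j : ℕ) = 0 then d else 0)

/-! ### The `U_q'(C_n^{(1)})` crystal `B_l` -/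

/-- Membership in the `C_n^{(1)}` crystal `B_l` : the sum of the entries belongs to
`{l, l-2, l-4, …}`. -/
def memC (n l : ℕ) (b : Tup n) : Prop := tsum b ≤ l ∧ (l - tsum b) % 2 = 0

def BC (n l : ℕ) : Set (Tup n) := {b | memC n l b}

/-- The number `x_0(b)` of `(0,0̄)` pairs. -/
def x0 (l : ℕ) {n : ℕ} (b : Tup n) : ℕ := (l - tsum b) / 2

/-- The operator `ẽ_i` on `B_l` (C case); `none` plays the role of `0`. -/
def eC (n l i : ℕ) (b : Tup n) : Option (Tup n) :=
  if i = 0 then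
    if 0 < n then
      if xbc b 1 + 2 ≤ xc b 1 then some (setx b.1 1 (xc b 1 - 2), b.2)
      else if xc b 1 = xbc b 1 + 1 then
        some (setx b.1 1 (xc b 1 - 1), setx b.2 1 (xbc b 1 + 1))
      else if tsum b + 2 ≤ l then some (b.1, setx b.2 1 (xbc b 1 + 2))
      else none
    else none
  else if i = n then
    if 0 < xbc b n then some (setx b.1 n (xc b n + 1), setx b.2 n (xbc b n - 1))
    else none
  else if i < n then
    if xbc b (i + 1) < xc b (i + 1) then
      some (setx (setx b.1 i (xc b i + 1)) (i + 1) (xc b (i + 1) - 1), b.2)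
    else if 0 < xbc b i then
      some (b.1, setx (setx b.2 (i + 1) (xbc b (i + 1) + 1)) i (xbc b i - 1))
    else none
  else none

/-- The operator `f̃_i` on `B_l` (C case). -/
def fC (n l i : ℕ) (b : Tup n) : Option (Tup n) :=
  if i = 0 then
    if 0 < n then
      if xbc b 1 ≤ xc b 1 then
        if tsum b + 2 ≤ l then some (setx b.1 1 (xc b 1 + 2), b.2) else none
      else if xc b 1 + 1 = xbc b 1 then
        some (setx b.1 1 (xc b 1 + 1), setx b.2 1 (xbc b 1 - 1))
      else some (b.1, setx b.2 1 (xbc b 1 - 2))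
    else none
  else if i = n then
    if 0 < xc b n then some (setx b.1 n (xc b n - 1), setx b.2 n (xbc b n + 1))
    else none
  else if i < n then
    if xbc b (i + 1) ≤ xc b (i + 1) then
      if 0 < xc b i then
        some (setx (setx b.1 i (xc b i - 1)) (i + 1) (xc b (i + 1) + 1), b.2)
      else none
    else some (b.1, setx (setx b.2 (i + 1) (xbc b (i + 1) - 1)) i (xbc b i + 1))
  else none

def eCIter (n l i m : ℕ) (b : Tup n) : Option (Tup n) :=
  (fun o => Option.bind o (eC n l i))^[m] (some b)

def fCIter (n l i m : ℕ) (b : Tup n) : Option (Tup n) :=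
  (fun o => Option.bind o (fC n l i))^[m] (some b)

/-- `ε_i(b) = max {m | ẽ_i^m b ≠ 0}` (C case). -/
noncomputable def epsC (n l i : ℕ) (b : Tup n) : ℕ :=
  sSup {m | eCIter n l i m b ≠ none}

/-- `φ_i(b) = max {m | f̃_i^m b ≠ 0}` (C case). -/
noncomputable def phiC (n l i : ℕ) (b : Tup n) : ℕ :=
  sSup {m | fCIter n l i m b ≠ none}

/-- `ẽ_i` on the tensor product `B_l ⊗ B_k` (C case). -/
noncomputable def eTenC (n l k i : ℕ) (u : Tup n × Tup n) : Option (Tup n × Tup n) :=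
  if epsC n k i u.2 ≤ phiC n l i u.1 then (eC n l i u.1).map (fun c => (c, u.2))
  else (eC n k i u.2).map (fun c => (u.1, c))

/-- `f̃_i` on the tensor product `B_l ⊗ B_k` (C case). -/
noncomputable def fTenC (n l k i : ℕ) (u : Tup n × Tup n) : Option (Tup n × Tup n) :=
  if epsC n k i u.2 < phiC n l i u.1 then (fC n l i u.1).map (fun c => (c, u.2))
  else (fC n k i u.2).map (fun c => (u.1, c))

/-- `ι : B_l ⊗ B_k → B_k ⊗ B_l` is an isomorphism of `U_q'(C_n^{(1)})` crystals. -/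
def IsIsoC (n l k : ℕ) (ι : Tup n × Tup n → Tup n × Tup n) : Prop :=
  Set.BijOn ι (BC n l ×ˢ BC n k) (BC n k ×ˢ BC n l) ∧
  ∀ u ∈ BC n l ×ˢ BC n k, ∀ i ≤ n,
    Option.map ι (eTenC n l k i u) = eTenC n k l i (ι u) ∧
    Option.map ι (fTenC n l k i u) = fTenC n k l i (ι u)

/-- `H` is an energy function for the isomorphism `ι` (C case), normalized by
`H((l,0,…,0) ⊗ (0,k,---,0)) = 0`. -/
def IsEnergyC (n l k : ℕ) (ι : Tup n × Tup n → Tup n × Tup n)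
    (H : Tup n × Tup n → ℤ) : Prop :=
  (∀ u ∈ BC n l ×ˢ BC n k, ∀ i ≤ n, ∀ v, eTenC n l k i u = some v →
      H v = H u +
        (if i = 0 then
          (if epsC n k 0 u.2 ≤ phiC n l 0 u.1 ∧ epsC n l 0 (ι u).2 ≤ phiC n k 0 (ι u).1
           then 1
           else if phiC n l 0 u.1 < epsC n k 0 u.2 ∧ phiC n k 0 (ι u).1 < epsC n l 0 (ι u).2
           then -1 else 0)
         else 0)) ∧
  H (uvec n l, u2vec n k) = 0

/-! ### The `U_q'(A_{2n-1}^{(2)})` crystal `B_l` -/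

def memA (n l : ℕ) (b : Tup n) : Prop := tsum b = l

def BA (n l : ℕ) : Set (Tup n) := {b | memA n l b}

/-- The operator `ẽ_i` (A case). -/
def eA (n i : ℕ) (b : Tup n) : Option (Tup n) :=
  if i = 0 then
    if 1 < n then
      if xbc b 2 < xc b 2 then some (setx b.1 2 (xc b 2 - 1), setx b.2 1 (xbc b 1 + 1))
      else if 0 < xc b 1 then some (setx b.1 1 (xc b 1 - 1), setx b.2 2 (xbc b 2 + 1))
      else none
    else none
  else if i = n then
    if 0 < xbc b n then some (setx b.1 n (xc b n + 1), setx b.2 n (xbc b n - 1))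
    else none
  else if i < n then
    if xbc b (i + 1) < xc b (i + 1) then
      some (setx (setx b.1 i (xc b i + 1)) (i + 1) (xc b (i + 1) - 1), b.2)
    else if 0 < xbc b i then
      some (b.1, setx (setx b.2 (i + 1) (xbc b (i + 1) + 1)) i (xbc b i - 1))
    else none
  else none

/-- The operator `f̃_i` (A case). -/
def fA (n i : ℕ) (b : Tup n) : Option (Tup n) :=
  if i = 0 then
    if 1 < n then
      if xbc b 2 ≤ xc b 2 then
        if 0 < xbc b 1 then some (setx b.1 2 (xc b 2 + 1), setx b.2 1 (xbc b 1 - 1))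
        else none
      else some (setx b.1 1 (xc b 1 + 1), setx b.2 2 (xbc b 2 - 1))
    else none
  else if i = n then
    if 0 < xc b n then some (setx b.1 n (xc b n - 1), setx b.2 n (xbc b n + 1))
    else none
  else if i < n then
    if xbc b (i + 1) ≤ xc b (i + 1) then
      if 0 < xc b i then
        some (setx (setx b.1 i (xc b i - 1)) (i + 1) (xc b (i + 1) + 1), b.2)
      else none
    else some (b.1, setx (setx b.2 (i + 1) (xbc b (i + 1) - 1)) i (xbc b i + 1))
  else none

def eAIter (n i m : ℕ) (b : Tup n) : Option (Tup n) :=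
  (fun o => Option.bind o (eA n i))^[m] (some b)

def fAIter (n i m : ℕ) (b : Tup n) : Option (Tup n) :=
  (fun o => Option.bind o (fA n i))^[m] (some b)

noncomputable def epsA (n i : ℕ) (b : Tup n) : ℕ :=
  sSup {m | eAIter n i m b ≠ none}

noncomputable def phiA (n i : ℕ) (b : Tup n) : ℕ :=
  sSup {m | fAIter n i m b ≠ none}

/-- `ẽ_i` on a tensor product (A case). -/
noncomputable def eTenA (n i : ℕ) (u : Tup n × Tup n) : Option (Tup n × Tup n) :=
  if epsA n i u.2 ≤ phiA n i u.1 then (eA n i u.1).map (fun c => (c, u.2))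
  else (eA n i u.2).map (fun c => (u.1, c))

/-- `f̃_i` on a tensor product (A case). -/
noncomputable def fTenA (n i : ℕ) (u : Tup n × Tup n) : Option (Tup n × Tup n) :=
  if epsA n i u.2 < phiA n i u.1 then (fA n i u.1).map (fun c => (c, u.2))
  else (fA n i u.2).map (fun c => (u.1, c))

/-- `ι : B_l ⊗ B_k → B_k ⊗ B_l` is an isomorphism of `U_q'(A_{2n-1}^{(2)})` crystals. -/
def IsIsoA (n l k : ℕ) (ι : Tup n × Tup n → Tup n × Tup n) : Prop :=
  Set.BijOn ι (BA n l ×ˢ BA n k) (BA n k ×ˢ BA n l) ∧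
  ∀ u ∈ BA n l ×ˢ BA n k, ∀ i ≤ n,
    Option.map ι (eTenA n i u) = eTenA n i (ι u) ∧
    Option.map ι (fTenA n i u) = fTenA n i (ι u)

/-- `H` is an energy function for `ι` (A case), normalized by
`H((l,0,…,0) ⊗ (0,0,---,k)) = 0`. -/
def IsEnergyA (n l k : ℕ) (ι : Tup n × Tup n → Tup n × Tup n)
    (H : Tup n × Tup n → ℤ) : Prop :=
  (∀ u ∈ BA n l ×ˢ BA n k, ∀ i ≤ n, ∀ v, eTenA n i u = some v →
      H v = H u +
        (if i = 0 then
          (if epsA n 0 u.2 ≤ phiA n 0 u.1 ∧ epsA n 0 (ι u).2 ≤ phiA n 0 (ι u).1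
           then 1
           else if phiA n 0 u.1 < epsA n 0 u.2 ∧ phiA n 0 (ι u).1 < epsA n 0 (ι u).2
           then -1 else 0)
         else 0)) ∧
  H (uvec n l, barvec n k) = 0

/-! ### Words, tableaux and column insertion

Letters are encoded as natural numbers: the unbarred letter `j` (for `0 ≤ j ≤ n`) is `j`,
and the barred letter `j̄` is `2n+1-j`; the natural order of `ℕ` is the order
`0 < 1 < ⋯ < n < n̄ < ⋯ < 1̄ < 0̄`.  A (two-row) tableau is encoded as the list of its
columns (left to right), each column being the list of its entries (top to bottom). -/

/-- The barred partner `j̄` of an unbarred letter `j`. -/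
def bar (n j : ℕ) : ℕ := 2 * n + 1 - j

/-- Column insertion of a letter into a tableau with at most two rows. -/
def insertLetter (n : ℕ) : ℕ → List (List ℕ) → List (List ℕ)
  | a, [] => [[a]]
  | a, [p] :: rest =>
      if a ≤ p then [a] :: insertLetter n p rest else [p, a] :: rest
  | a, [p, q] :: rest =>
      if p ≠ 0 ∧ p ≤ n ∧ q = bar n p ∧ p ≤ a ∧ a ≤ q then
        -- the column is a pair `(x, x̄)` with `x ≠ 0` and `x ≤ a ≤ x̄`
        [p - 1, a] :: insertLetter n (bar n (p - 1)) rest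
      else if n + 1 ≤ q ∧ bar n q < p ∧ p < q ∧ a = bar n q ∧ q ≠ n + 1 then
        -- the column is `(β, x̄)` with `x < β < x̄`, `a = x` and `x ≠ n`
        [a + 1, bar n (a + 1)] :: insertLetter n p rest
      else if a ≤ p then [a, q] :: insertLetter n p rest
      else if a ≤ q then [p, a] :: insertLetter n q rest
      else [p, q, a] :: rest
  | a, C :: rest => (C ++ [a]) :: rest

/-- Column insertion of a word `u = u_1 ⋯ u_j` into a tableau: `u_j` first, `u_1` last. -/
def insertWord (n : ℕ) (u : List ℕ) (T : List (List ℕ)) : List (List ℕ) :=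
  u.foldr (fun a T => insertLetter n a T) T

/-- One step of reverse insertion: letter `g` comes back (moving leftward) into a column;
returns the restored column together with the letter passed further left. -/
def revStep (n g : ℕ) (C : List ℕ) : List ℕ × ℕ :=
  match C with
  | [p] => ([g], p)
  | [p, q] =>
      if p ≠ 0 ∧ p ≤ n ∧ q = bar n p ∧ p ≤ g ∧ g ≤ q then
        ([g, bar n (p - 1)], p - 1)
      else if p ≤ n ∧ g = bar n p ∧ p < q ∧ q < g ∧ p ≠ n then
        ([p + 1, bar n (p + 1)], q)
      else if q ≤ g then ([p, g], q)
      else ([g, q], p)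
  | _ => (C, g)

/-- Reverse insertion of a letter through a list of columns, from right to left;
returns the new columns and the letter ejected from the leftmost column. -/
def revPass (n g : ℕ) : List (List ℕ) → List (List ℕ) × ℕ
  | [] => ([], g)
  | C :: rest =>
      let p := revPass n g rest
      let q := revStep n p.2 C
      (q.1 :: p.1, q.2)

/-- Reverse-bump the rightmost cell of the first row (the last column, a single box). -/
def rbFirst (n : ℕ) (T : List (List ℕ)) : List (List ℕ) × ℕ :=
  match T.getLast? with
  | some [a] => revPass n a T.dropLast
  | _ => (T, 0)

/-- Number of columns of height (at least) two, i.e. the length of the second row. -/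
def numTwoCols (T : List (List ℕ)) : ℕ :=
  (T.filter (fun C => decide (2 ≤ C.length))).length

/-- Reverse-bump the rightmost cell of the second row. -/
def rbSecond (n : ℕ) (T : List (List ℕ)) : List (List ℕ) × ℕ :=
  match (T.drop (numTwoCols T - 1)).head? with
  | some [a, b] =>
      let p := revPass n b (T.take (numTwoCols T - 1))
      (p.1 ++ [a] :: T.drop (numTwoCols T), p.2)
  | _ => (T, 0)

/-- Iterate a reverse-bumping step, collecting the ejected letters in order of ejection. -/
def rbIter (step : List (List ℕ) → List (List ℕ) × ℕ) :
    ℕ → List (List ℕ) → List (List ℕ) × List ℕ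
  | 0, T => (T, [])
  | c + 1, T =>
      let p := step T
      let q := rbIter step c p.1
      (q.1, p.2 :: q.2)

/-- A one-row word regarded as a tableau (list of one-box columns). -/
def rowCols (w : List ℕ) : List (List ℕ) := w.map (fun a => [a])

/-- The row word of a one-row tableau. -/
def colsWord (T : List (List ℕ)) : List ℕ := T.foldr (fun C acc => C ++ acc) []

/-- The word `1^{x_1} ⋯ n^{x_n} n̄^{x̄_n} ⋯ 1̄^{x̄_1}`. -/
def coreWord (n : ℕ) (b : Tup n) : List ℕ :=
  ((List.finRange n).map (fun i => List.replicate (b.1 i) ((i : ℕ) + 1))).foldr (· ++ ·) []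
  ++ ((List.finRange n).reverse.map
      (fun i => List.replicate (b.2 i) (bar n ((i : ℕ) + 1)))).foldr (· ++ ·) []

/-- The word `𝕋(b) = 0^{x_0} 1^{x_1} ⋯ 1̄^{x̄_1} 0̄^{x_0}` of an element of the
`C_n^{(1)}` crystal `B_l`. -/
def rowWordC (n l : ℕ) (b : Tup n) : List ℕ :=
  List.replicate (x0 l b) 0 ++ coreWord n b ++ List.replicate (x0 l b) (bar n 0)

/-- The word `𝕋(b)` with `z` pairs `(0, 0̄)` removed. -/
def hatWordC (n l z : ℕ) (b : Tup n) : List ℕ :=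
  List.replicate (x0 l b - z) 0 ++ coreWord n b ++ List.replicate (x0 l b - z) (bar n 0)

/-- The word `𝒯(b) = 1^{x_1} ⋯ 1̄^{x̄_1}` of an element of the `A_{2n-1}^{(2)}` crystal. -/
def rowWordA (n : ℕ) (b : Tup n) : List ℕ := coreWord n b


theorem xc_set {n : ℕ} (f g : Fin n → ℕ) (i v j : ℕ) (h1 : 1 ≤ j) (h2 : j ≤ n) :
    xc (setx f i v, g) j = if j = i then v else xc (f, g) j := by
  have h : j - 1 < n := by omega
  have e : j - 1 + 1 = j := by omega
  simp [xc, setx, h, e]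

theorem xbc_set {n : ℕ} (f g : Fin n → ℕ) (i v j : ℕ) (h1 : 1 ≤ j) (h2 : j ≤ n) :
    xbc (f, setx g i v) j = if j = i then v else xbc (f, g) j := by
  have h : j - 1 < n := by omega
  have e : j - 1 + 1 = j := by omega
  simp [xbc, setx, h, e]

theorem xc_fst {n : ℕ} (f g g' : Fin n → ℕ) (j : ℕ) : xc (f, g) j = xc (f, g') j := rfl
theorem xbc_snd {n : ℕ} (f f' g : Fin n → ℕ) (j : ℕ) : xbc (f, g) j = xbc (f', g) j := rfl

theorem iter_none {α : Type*} (g : α → Option α) (m : ℕ) :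
    (fun o => Option.bind o g)^[m] none = none := by
  induction m with
  | zero => rfl
  | succ m ih => rw [Function.iterate_succ_apply]; exact ih

theorem iter_iff {α : Type*} (g : α → Option α) (M : α → ℕ)
    (h1 : ∀ b, g b = none → M b = 0) (h2 : ∀ b c, g b = some c → M c + 1 = M b)
    (m : ℕ) (b : α) : (fun o => Option.bind o g)^[m] (some b) ≠ none ↔ m ≤ M b := by
  induction m generalizing b with
  | zero => simp
  | succ m ih =>
    rw [Function.iterate_succ_apply]
    rcases hg : g b with _ | c
    · have := h1 b hg
      simp [hg, iter_none, this]
    · have := h2 b c hg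
      have e : Option.bind (some b) g = some c := by simp [hg]
      simp only [e]
      rw [ih]; omega

theorem sSup_iter {α : Type*} (g : α → Option α) (M : α → ℕ)
    (h1 : ∀ b, g b = none → M b = 0) (h2 : ∀ b c, g b = some c → M c + 1 = M b) (b : α) :
    sSup {m | (fun o => Option.bind o g)^[m] (some b) ≠ none} = M b := by
  have : {m | (fun o => Option.bind o g)^[m] (some b) ≠ none} = Set.Iic (M b) := by
    ext m; simp only [Set.mem_setOf_eq, Set.mem_Iic]; exact iter_iff g M h1 h2 m b
  rw [this, csSup_Iic]

def Me (n i : ℕ) (b : Tup n) : ℕ :=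
  if i = n then xbc b n else xbc b i + (xc b (i+1) - xbc b (i+1))

def Mf (n i : ℕ) (b : Tup n) : ℕ :=
  if i = n then xc b n else xc b i + (xbc b (i+1) - xc b (i+1))

theorem eC_none {n l i : ℕ} (hi : 1 ≤ i) (hin : i ≤ n) (b : Tup n) (h : eC n l i b = none) :
    Me n i b = 0 := by
  unfold eC at h
  unfold Me
  split_ifs at h ⊢ <;> first | omega | simp_all

theorem fC_none {n l i : ℕ} (hi : 1 ≤ i) (hin : i ≤ n) (b : Tup n) (h : fC n l i b = none) :
    Mf n i b = 0 := by
  unfold fC at h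
  unfold Mf
  split_ifs at h ⊢ <;> first | omega | simp_all

theorem eC_some {n l i : ℕ} (hi : 1 ≤ i) (hin : i ≤ n) (b c : Tup n)
    (h : eC n l i b = some c) : Me n i c + 1 = Me n i b := by
  obtain ⟨f, g⟩ := b
  unfold eC at h
  unfold Me
  by_cases hn : i = n
  · subst hn
    rw [if_neg (by omega), if_pos rfl] at h
    split_ifs at h
    cases h
    rw [if_pos rfl, if_pos rfl, xbc_set _ _ _ _ _ hi hin, if_pos rfl]
    omega
  · rw [if_neg (by omega), if_neg hn, if_pos (by omega)] at h
    rw [if_neg hn, if_neg hn]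
    have hs : 1 ≤ i + 1 := by omega
    have hs' : i + 1 ≤ n := by omega
    have ne : i ≠ i + 1 := by omega
    have ne' : i + 1 ≠ i := by omega
    split_ifs at h with h1 h2 <;> cases h
    · rw [xc_set _ _ _ _ _ hs hs', if_pos rfl]
      rw [xbc_snd _ f g i, xbc_snd _ f g (i+1)]; omega
    · rw [xbc_set _ _ _ _ _ hs hs', xbc_set _ _ _ _ _ hi hin, xbc_set _ _ _ _ _ hs hs',
        if_pos rfl, if_pos rfl, if_neg ne', xc_fst f _ g]
      omega

theorem fC_some {n l i : ℕ} (hi : 1 ≤ i) (hin : i ≤ n) (b c : Tup n)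
    (h : fC n l i b = some c) : Mf n i c + 1 = Mf n i b := by
  obtain ⟨f, g⟩ := b
  unfold fC at h
  unfold Mf
  by_cases hn : i = n
  · subst hn
    rw [if_neg (by omega), if_pos rfl] at h
    split_ifs at h
    cases h
    rw [if_pos rfl, if_pos rfl, xc_set _ _ _ _ _ hi hin, if_pos rfl]
    omega
  · rw [if_neg (by omega), if_neg hn, if_pos (by omega)] at h
    rw [if_neg hn, if_neg hn]
    have hs : 1 ≤ i + 1 := by omega
    have hs' : i + 1 ≤ n := by omega
    have ne : i ≠ i + 1 := by omega
    have ne' : i + 1 ≠ i := by omega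
    split_ifs at h with h1 h2 <;> cases h
    · rw [xc_set _ _ _ _ _ hs hs', xc_set _ _ _ _ _ hi hin, xc_set _ _ _ _ _ hi hin,
        if_pos rfl, if_pos rfl, if_neg ne, xbc_snd _ f g]
      omega
    · rw [xbc_set _ _ _ _ _ hs hs', if_neg ne', xbc_set _ _ _ _ _ hs hs', if_pos rfl,
        xc_fst f _ g i, xc_fst f _ g (i+1)]
      omega

theorem epsC_eq {n l i : ℕ} (hi : 1 ≤ i) (hin : i ≤ n) (b : Tup n) :
    epsC n l i b = Me n i b :=
  sSup_iter (eC n l i) (Me n i) (eC_none hi hin) (eC_some hi hin) b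

theorem phiC_eq {n l i : ℕ} (hi : 1 ≤ i) (hin : i ≤ n) (b : Tup n) :
    phiC n l i b = Mf n i b :=
  sSup_iter (fC n l i) (Mf n i) (fC_none hi hin) (fC_some hi hin) b

theorem high {n l k i : ℕ} (hi : 1 ≤ i) (hin : i ≤ n) (b1 b2 : Tup n)
    (h : eTenC n l k i (b1, b2) = none) : Me n i b1 = 0 ∧ Me n i b2 ≤ Mf n i b1 := by
  unfold eTenC at h
  simp only [epsC_eq hi hin, phiC_eq hi hin] at h
  split_ifs at h with h1
  · rw [Option.map_eq_none_iff] at h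
    exact ⟨eC_none hi hin _ h, h1⟩
  · rw [Option.map_eq_none_iff] at h
    have := eC_none hi hin _ h
    omega

theorem tsum_triple (n a c d : ℕ) (hn : 2 ≤ n) : tsum (tripleVec n a c d) = a + c + d := by
  obtain ⟨m, rfl⟩ : ∃ m, n = m + 2 := ⟨n - 2, by omega⟩
  simp [tsum, tripleVec, Fin.sum_univ_succ]
  omega

theorem tup_eq {n : ℕ} (b c : Tup n)
    (h : ∀ j, 1 ≤ j → j ≤ n → xc b j = xc c j ∧ xbc b j = xbc c j) : b = c := by
  apply Prod.ext <;> funext t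
  · have := (h (t + 1) (by omega) (by omega)).1
    simpa [xc] using this
  · have := (h (t + 1) (by omega) (by omega)).2
    simpa [xbc] using this

theorem xc_triple {n a c d j : ℕ} (h1 : 1 ≤ j) (h2 : j ≤ n) :
    xc (tripleVec n a c d) j = if j = 1 then a else if j = 2 then c else 0 := by
  have h : j - 1 < n := by omega
  simp only [xc, tripleVec, h, dite_true]
  split_ifs <;> omega

theorem xbc_triple {n a c d j : ℕ} (h1 : 1 ≤ j) (h2 : j ≤ n) :
    xbc (tripleVec n a c d) j = if j = 1 then d else 0 := by
  have h : j - 1 < n := by omega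
  simp only [xbc, tripleVec, h, dite_true]
  split_ifs <;> omega

theorem uvec_eq (n v : ℕ) : uvec n v = tripleVec n v 0 0 := by
  simp [uvec, tripleVec]

theorem bars_zero {n i0 : ℕ} (hi0 : 1 ≤ i0) (b : Tup n)
    (h : ∀ i, i0 ≤ i → i ≤ n → Me n i b = 0) :
    (∀ j, i0 ≤ j → j ≤ n → xbc b j = 0) ∧ (∀ j, i0 + 1 ≤ j → j ≤ n → xc b j = 0) := by
  have hb : ∀ j, i0 ≤ j → j ≤ n → xbc b j = 0 := by
    intro j h1 h2
    have := h j h1 h2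
    unfold Me at this
    split_ifs at this with e
    · rw [e]; exact this
    · omega
  refine ⟨hb, fun j h1 h2 => ?_⟩
  have := h (j - 1) (by omega) (by omega)
  have e : j - 1 + 1 = j := by omega
  rw [Me, if_neg (by omega), e, hb j (by omega) h2] at this
  omega

theorem classification_highest_C
    (n l k : ℕ) (hn : 2 ≤ n) (hk : 1 ≤ k) (hkl : k ≤ l)
    (b1 b2 : Tup n) (hb1 : b1 ∈ BC n l) (hb2 : b2 ∈ BC n k)
    (hhigh : ∀ i, 1 ≤ i → i ≤ n → eTenC n l k i (b1, b2) = none)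
    (h0 : x0 l b1 = 0 ∨ x0 k b2 = 0) :
    Xor'
      (b1 = uvec n l ∧ ∃ a c d : ℕ, a + c + d ≤ k ∧ b2 = tripleVec n a c d)
      (∃ y a c : ℕ, y ≠ 0 ∧ (2 * (y : ℤ) - (a : ℤ) ≤ (l : ℤ) - (k : ℤ)) ∧ a + c ≤ k ∧
        b1 = uvec n (l - 2 * y) ∧ b2 = tripleVec n a c (k - a - c)) := by
  have H := fun i h1 h2 => high h1 h2 b1 b2 (hhigh i h1 h2)
  obtain ⟨B1, X1⟩ := bars_zero le_rfl b1 (fun i h1 h2 => (H i h1 h2).1)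
  obtain ⟨B2, X2⟩ := bars_zero (i0 := 2) (by omega) b2 (fun i h1 h2 => by
    have := (H i (by omega) h2).2
    have hx := X1 i h1 h2
    unfold Mf at this
    split_ifs at this with e
    · rw [e] at hx; omega
    · have := B1 (i + 1) (by omega) (by omega)
      omega)
  have hone := (H 1 le_rfl (by omega)).2
  rw [Me, Mf, if_neg (by omega), if_neg (by omega), B1 (1+1) (by omega) (by omega),
    B2 (1+1) (by omega) (by omega)] at hone
  have E1 : b1 = tripleVec n (xc b1 1) 0 0 := by
    apply tup_eq
    intro j h1 h2
    rw [xc_triple h1 h2, xbc_triple h1 h2, B1 j h1 h2]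
    refine ⟨?_, by simp⟩
    split_ifs with e e'
    · rw [e]
    · exact X1 j (by omega) h2
    · exact X1 j (by omega) h2
  have E2 : b2 = tripleVec n (xc b2 1) (xc b2 2) (xbc b2 1) := by
    apply tup_eq
    intro j h1 h2
    rw [xc_triple h1 h2, xbc_triple h1 h2]
    constructor
    · split_ifs with e e'
      · rw [e]
      · rw [e']
      · exact X2 j (by omega) h2
    · split_ifs with e
      · rw [e]
      · exact B2 j (by omega) h2
  simp only [Nat.reduceAdd] at hone
  generalize xc b1 1 = v at *
  generalize xc b2 1 = a at *
  generalize xc b2 2 = c at *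
  generalize xbc b2 1 = d at *
  obtain ⟨p1, q1⟩ : memC n l b1 := hb1
  obtain ⟨p2, q2⟩ : memC n k b2 := hb2
  have t1 : tsum b1 = v := by rw [E1, tsum_triple _ _ _ _ hn]; rfl
  have t2 : tsum b2 = a + c + d := by rw [E2, tsum_triple _ _ _ _ hn]
  unfold x0 at h0
  rw [t1] at p1 q1 h0
  rw [t2] at p2 q2 h0
  have ts : ∀ w, b1 = uvec n w → v = w := by
    intro w hw
    rw [← t1, hw, uvec_eq, tsum_triple _ _ _ _ hn]; rfl
  by_cases hv : v = l
  · left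
    refine ⟨⟨by rw [uvec_eq, ← hv]; exact E1, a, c, d, p2, E2⟩, ?_⟩
    rintro ⟨y, a', c', hy, -, -, hb, -⟩
    have := ts _ hb
    omega
  · right
    refine ⟨⟨(l - v) / 2, a, c, by omega, by omega, by omega, ?_, ?_⟩, ?_⟩
    · rw [uvec_eq, show l - 2 * ((l - v) / 2) = v by omega]; exact E1
    · rw [show k - a - c = d by omega]; exact E2
    · rintro ⟨hb, -⟩
      exact hv (ts _ hb)
end KTT
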